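/- For every real ε > 0 there exists K such that for every integer k ≥ K, every outer k-planar graph on n vertices has at most (√2 + ε)·√k·n + n edges. -/

import Mathlib

open scoped Classical

/-- A point in the plane. -/
abbrev Pt := EuclideanSpace ℝ (Fin 2)

/-- A finite point set is in convex position (convexly independent). -/
def ConvexPos (V : Finset Pt) : Prop :=
  ∀ p ∈ V, p ∉ convexHull ℝ ((V.erase p : Finset Pt) : Set Pt)

/-- The open straight-line segment drawn for an unordered pair of points. -/
noncomputable def edgeSeg (e : Sym2 Pt) : Set Pt :=
  Sym2.lift ⟨fun a b => openSegment ℝ a b, fun a b => openSegment_symm ℝ a b⟩ e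

/-- Two distinct edges cross if their open segments intersect. -/
def Cross (e f : Sym2 Pt) : Prop :=
  e ≠ f ∧ (edgeSeg e ∩ edgeSeg f).Nonempty

theorem Cross_comm (e f : Sym2 Pt) : Cross e f ↔ Cross f e := by
  unfold Cross
  rw [Set.inter_comm]
  exact and_congr_left' ne_comm

/-- A convex geometric graph: points in convex position, edges are unordered
pairs of distinct points of `V`. -/
structure ConvexGeomGraph where
  V : Finset Pt
  E : Finset (Sym2 Pt)
  convexPos : ConvexPos V
  not_diag : ∀ e ∈ E, ¬ e.IsDiag
  mem_V : ∀ e ∈ E, ∀ p ∈ e, p ∈ V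

/-- A convex geometric graph is outer `k`-planar if every edge crosses at
most `k` other edges. -/
noncomputable def OuterKPlanar (G : ConvexGeomGraph) (k : ℕ) : Prop :=
  ∀ e ∈ G.E, (G.E.filter (fun f => Cross e f)).card ≤ k

/-- Bipartite: vertices can be partitioned into `A` and `B` with every edge
joining a point of `A` to a point of `B`. -/
def Bipartite (G : ConvexGeomGraph) : Prop :=
  ∃ A B : Finset Pt, A ∪ B = G.V ∧ Disjoint A B ∧
    ∀ e ∈ G.E, ∃ a ∈ A, ∃ b ∈ B, e = s(a, b)

/-- The degree of a vertex: number of edges containing it. -/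
noncomputable def degree (G : ConvexGeomGraph) (v : Pt) : ℕ :=
  (G.E.filter (fun e => v ∈ e)).card

/-- The number of unordered pairs of distinct edges that cross. -/
noncomputable def crossingNumber (E : Finset (Sym2 Pt)) : ℕ :=
  (E.sym2.filter (fun pr => Sym2.lift
    ⟨fun e f => Cross e f, fun e f => propext (Cross_comm e f)⟩ pr)).card

/-- Twice the signed area of the triangle `p q r`. -/
noncomputable def orient (p q r : Pt) : ℝ :=
  (q 0 - p 0) * (r 1 - p 1) - (q 1 - p 1) * (r 0 - p 0)

theorem orient_swap (p q r : Pt) : orient p r q = -orient p q r := by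
  unfold orient; ring

theorem ConvexPos.not_barycenter {V : Finset Pt} (hV : ConvexPos V) {p a b c : Pt}
    (hp : p ∈ V) (ha : a ∈ V) (hb : b ∈ V) (hc : c ∈ V) (hap : a ≠ p) (hbp : b ≠ p) (hcp : c ≠ p)
    {x y z : ℝ} (hx : 0 ≤ x) (hy : 0 ≤ y) (hz : 0 ≤ z) (hs : 0 < x + y + z)
    (h : ∀ i, x * a i + y * b i + z * c i = (x + y + z) * p i) : False := by
  apply hV p hp
  have hmem : ∀ q ∈ V, q ≠ p → q ∈ convexHull ℝ ((V.erase p : Finset Pt) : Set Pt) :=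
    fun q hq hqp => subset_convexHull ℝ _ (by simp [hq, hqp])
  have hconv := convex_convexHull ℝ ((V.erase p : Finset Pt) : Set Pt)
  have key := hconv.sum_mem (t := Finset.univ) (w := ![x / (x + y + z), y / (x + y + z),
    z / (x + y + z)]) (z := ![a, b, c])
    (by intro i _; fin_cases i <;> simp <;> positivity)
    (by simp [Fin.sum_univ_three]; field_simp)
    (by intro i _; fin_cases i; exacts [hmem a ha hap, hmem b hb hbp, hmem c hc hcp])
  convert key using 1
  ext i
  simp only [Fin.sum_univ_three, Matrix.cons_val_zero, Matrix.cons_val_one, Matrix.cons_val,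
    PiLp.add_apply, PiLp.smul_apply, smul_eq_mul]
  field_simp
  linarith [h i]

theorem ConvexPos.orient_ne_zero {V : Finset Pt} (hV : ConvexPos V) {p q r : Pt}
    (hp : p ∈ V) (hq : q ∈ V) (hr : r ∈ V) (hpq : q ≠ p) (hpr : r ≠ p) (hqr : q ≠ r) :
    orient p q r ≠ 0 := by
  intro h
  unfold orient at h
  set t := (q 0 - p 0) * (r 0 - p 0) + (q 1 - p 1) * (r 1 - p 1) with ht
  set n := (r 0 - p 0) ^ 2 + (r 1 - p 1) ^ 2 with hn
  have hn0 : 0 < n := by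
    by_contra! hle
    apply hpr
    ext i
    have h0 : r 0 - p 0 = 0 := by nlinarith [sq_nonneg (r 0 - p 0), sq_nonneg (r 1 - p 1)]
    have h1 : r 1 - p 1 = 0 := by nlinarith [sq_nonneg (r 0 - p 0), sq_nonneg (r 1 - p 1)]
    fin_cases i <;> simp <;> linarith
  have hpar : ∀ i, n * (q i - p i) = t * (r i - p i) := by
    intro i
    fin_cases i
    · simp only [Fin.zero_eta, hn, ht]; linear_combination (r 1 - p 1) * h
    · simp only [Fin.mk_one, hn, ht]; linear_combination -(r 0 - p 0) * h
  rcases le_total t 0 with h0 | h0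
  · exact hV.not_barycenter hp hq hr hr hpq hpr hpr hn0.le (neg_nonneg.2 h0) le_rfl (by linarith)
      (fun i => by linear_combination hpar i)
  · rcases le_total t n with h1 | h1
    · exact hV.not_barycenter hq hr hp hp hqr.symm hpq.symm hpq.symm h0 (sub_nonneg.2 h1) le_rfl
        (by linarith) (fun i => by linear_combination -hpar i)
    · exact hV.not_barycenter hr hq hp hp hqr hpr.symm hpr.symm hn0.le (sub_nonneg.2 h1) le_rfl
        (by linarith) (fun i => by linear_combination hpar i)

theorem ConvexPos.orient_trans {V : Finset Pt} (hV : ConvexPos V) {p q r s : Pt}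
    (hp : p ∈ V) (hq : q ∈ V) (hr : r ∈ V) (hs : s ∈ V) (hpq : q ≠ p) (hpr : r ≠ p) (hps : s ≠ p)
    (h₁ : 0 < orient p q r) (h₂ : 0 < orient p r s) : 0 < orient p q s := by
  by_contra! h
  refine hV.not_barycenter hp hq hr hs hpq hpr hps h₂.le (neg_nonneg.2 h) h₁.le (by linarith) ?_
  intro i
  unfold orient
  fin_cases i <;> simp <;> ring

theorem ConvexPos.orient_pos_of_fan {V : Finset Pt} (hV : ConvexPos V) {p b c d : Pt}
    (hp : p ∈ V) (hb : b ∈ V) (hc : c ∈ V) (hd : d ∈ V) (hcp : c ≠ p) (hbc : b ≠ c) (hcd : d ≠ c)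
    (h₁ : 0 < orient p b c) (h₂ : 0 < orient p c d) : 0 < orient b c d := by
  by_contra! h
  refine hV.not_barycenter hc hb hd hp hbc hcd hcp.symm h₂.le h₁.le (neg_nonneg.2 h)
    (by linarith) ?_
  intro i
  unfold orient
  fin_cases i <;> simp <;> ring

/-- Points in convex position can be numbered counterclockwise. -/
theorem ConvexPos.exists_numbering {V : Finset Pt} (hV : ConvexPos V) :
    ∃ f : Pt → ℕ, Set.InjOn f V ∧
      ∀ a ∈ V, ∀ b ∈ V, ∀ c ∈ V, f a < f b → f b < f c → 0 < orient a b c := by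
  rcases V.eq_empty_or_nonempty with rfl | ⟨p, hp⟩
  · exact ⟨fun _ => 0, by simp, by simp⟩
  let f : Pt → ℕ := fun q =>
    if q = p then 0 else 1 + ((V.erase p).filter fun r => 0 < orient p r q).card
  have hlt : ∀ q ∈ V, ∀ r ∈ V, q ≠ p → r ≠ p → 0 < orient p q r → f q < f r := by
    intro q hq r hr hqp hrp h
    simp only [f, hqp, hrp, if_false]
    refine Nat.add_lt_add_left (Finset.card_lt_card ?_) 1
    refine (Finset.ssubset_iff_of_subset ?_).2 ⟨q, ?_, ?_⟩
    · intro t ht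
      simp only [Finset.mem_filter, Finset.mem_erase] at ht ⊢
      exact ⟨ht.1, hV.orient_trans hp ht.1.2 hq hr ht.1.1 hqp hrp ht.2 h⟩
    · simp [hq, hqp, h]
    · simp [orient, mul_comm]
  have hpos : ∀ q, q ≠ p → 0 < f q := by
    intro q hq
    simp only [f, hq, if_false]
    omega
  have hfp : f p = 0 := by simp [f]
  have htot : ∀ q ∈ V, ∀ r ∈ V, q ≠ p → r ≠ p → q ≠ r →
      0 < orient p q r ∨ 0 < orient p r q := by
    intro q hq r hr hqp hrp hqr
    rw [orient_swap p q r, neg_pos]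
    exact (hV.orient_ne_zero hp hq hr hqp hrp hqr).lt_or_gt.symm
  have hconv : ∀ q ∈ V, ∀ r ∈ V, q ≠ p → r ≠ p → f q < f r → 0 < orient p q r := by
    intro q hq r hr hqp hrp h
    rcases htot q hq r hr hqp hrp (by rintro rfl; exact lt_irrefl _ h) with h' | h'
    · exact h'
    · exact absurd (hlt r hr q hq hrp hqp h') h.not_gt
  refine ⟨f, ?_, ?_⟩
  · intro q hq r hr hqr
    by_contra hne
    by_cases hqp : q = p
    · subst hqp
      have := hpos r (Ne.symm hne)
      omega
    by_cases hrp : r = p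
    · subst hrp
      have := hpos q hne
      omega
    rcases htot q hq r hr hqp hrp hne with h | h
    · exact (hlt q hq r hr hqp hrp h).ne hqr
    · exact (hlt r hr q hq hrp hqp h).ne hqr.symm
  · intro a ha b hb c hc hab hbc
    have hbp : b ≠ p := by rintro rfl; omega
    have hcp : c ≠ p := by rintro rfl; omega
    have hbc' := hconv b hb c hc hbp hcp hbc
    by_cases hap : a = p
    · rwa [hap]
    · exact hV.orient_pos_of_fan hp ha hb hc hbp (by rintro rfl; omega) (by rintro rfl; omega)
        (hconv a ha b hb hap hbp hab) hbc'

theorem openSegment_inter_nonempty_of_orient_pos {a b c d : Pt} (habc : 0 < orient a b c)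
    (habd : 0 < orient a b d) (hacd : 0 < orient a c d) (hbcd : 0 < orient b c d) :
    (openSegment ℝ a c ∩ openSegment ℝ b d).Nonempty := by
  have hsum : orient b c d + orient a b d = orient a c d + orient a b c := by
    unfold orient; ring
  set S := orient a c d + orient a b c with hS
  have hS0 : 0 < S := by positivity
  refine ⟨(orient b c d / S) • a + (orient a b d / S) • c,
    ⟨_, _, div_pos hbcd hS0, div_pos habd hS0, ?_, rfl⟩,
    ⟨orient a c d / S, orient a b c / S, div_pos hacd hS0, div_pos habc hS0, ?_, ?_⟩⟩
  · rw [← add_div, hsum, div_self hS0.ne']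
  · rw [← add_div, div_self hS0.ne']
  · ext i
    simp only [PiLp.add_apply, PiLp.smul_apply, smul_eq_mul]
    field_simp
    unfold orient
    fin_cases i <;> simp <;> ring

/-- Among `m ≥ s` points on a line, the number of pairs at rank distance at most `s`. -/
theorem two_mul_card_short_pairs_add_le (U : Finset ℕ) (s : ℕ) (hs : s ≤ U.card)
    (F : Finset (ℕ × ℕ))
    (hF : ∀ e ∈ F, e.1 < e.2 ∧ e.1 ∈ U ∧ e.2 ∈ U ∧ (U.filter (· ∈ Set.Ioc e.1 e.2)).card ≤ s) :
    2 * F.card + s * (s + 1) ≤ 2 * s * U.card := by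
  let rank : ℕ → ℕ := fun a => (U.filter (· < a)).card
  have rank_lt : ∀ a ∈ U, ∀ b, a < b → rank a < rank b := by
    intro a ha b hab
    refine Finset.card_lt_card ((Finset.ssubset_iff_of_subset ?_).2 ⟨a, ?_, ?_⟩)
    · intro x; simp only [Finset.mem_filter]; intro hx; exact ⟨hx.1, hx.2.trans hab⟩
    · simp [ha, hab]
    · simp
  have rank_inj : ∀ a ∈ U, ∀ b ∈ U, rank a = rank b → a = b := by
    intro a ha b hb h
    rcases lt_trichotomy a b with hab | hab | hab
    · exact absurd h (rank_lt a ha b hab).ne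
    · exact hab
    · exact absurd h (rank_lt b hb a hab).ne'
  have rank_lt_card : ∀ a ∈ U, rank a < U.card := by
    intro a ha
    exact Finset.card_lt_card ((Finset.ssubset_iff_of_subset (Finset.filter_subset _ _)).2
      ⟨a, ha, by simp⟩)
  have rank_diff : ∀ a ∈ U, ∀ b ∈ U, a < b →
      rank b ≤ rank a + (U.filter (· ∈ Set.Ioc a b)).card := by
    intro a ha b hb hab
    have h1 : (U.filter (· < b)) ⊆ U.filter (· < a) ∪ (insert a (U.filter (· ∈ Set.Ioo a b))) := by
      intro x
      simp only [Finset.mem_filter, Finset.mem_union, Finset.mem_insert, Set.mem_Ioo]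
      grind
    have h2 : (insert b (U.filter (· ∈ Set.Ioo a b))) ⊆ U.filter (· ∈ Set.Ioc a b) := by
      intro x
      simp only [Finset.mem_filter, Finset.mem_insert, Set.mem_Ioo, Set.mem_Ioc]
      grind
    have h3 := (Finset.card_le_card h1).trans (Finset.card_union_le _ _)
    have h4 := Finset.card_le_card h2
    rw [Finset.card_insert_of_notMem (by simp)] at h3 h4
    simp only [rank]
    omega
  have hcard : F.card ≤ ((Finset.Icc 1 s).sigma fun t => Finset.Ico t U.card).card := by
    refine Finset.card_le_card_of_injOn
      (fun e => (⟨rank e.2 - rank e.1, rank e.2⟩ : Σ _ : ℕ, ℕ)) ?_ ?_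
    · intro e he
      obtain ⟨h, h1, h2, h3⟩ := hF e he
      have := rank_lt e.1 h1 e.2 h
      have := rank_lt_card e.2 h2
      have := rank_diff e.1 h1 e.2 h2 h
      simp only [Finset.coe_sigma, Set.mem_sigma_iff, Finset.coe_Icc, Finset.coe_Ico, Set.mem_Icc,
        Set.mem_Ico]
      omega
    · intro e he e' he' h
      obtain ⟨hl, h1, h2, h3⟩ := hF e he
      obtain ⟨hl', h1', h2', h3'⟩ := hF e' he'
      simp only [Sigma.mk.injEq, heq_eq_eq] at h
      have := rank_lt e.1 h1 e.2 hl
      have := rank_lt e'.1 h1' e'.2 hl'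
      exact Prod.ext (rank_inj _ h1 _ h1' (by omega)) (rank_inj _ h2 _ h2' h.2)
  have hsum : ∀ s, s ≤ U.card →
      2 * (∑ t ∈ Finset.Icc 1 s, (U.card - t)) + s * (s + 1) = 2 * s * U.card := by
    intro s
    induction s with
    | zero => simp
    | succ s ih =>
      intro h
      rw [Finset.sum_Icc_succ_top (by omega)]
      have := ih (by omega)
      obtain ⟨c, hc⟩ := Nat.exists_eq_add_of_le h
      have : U.card - (s + 1) = c := by omega
      rw [this]
      nlinarith
  rw [Finset.card_sigma] at hcard
  simp only [Nat.card_Ico] at hcard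
  have := hsum s hs
  omega

/-- The edge bound for ordered graphs in which every edge is interleaved with at most `k` others. -/
theorem two_mul_card_edges_le (k s : ℕ) (hs : 1 ≤ s) (hks : 2 * k ≤ s * s) (V : Finset ℕ)
    (E : Finset (ℕ × ℕ)) (hE : ∀ e ∈ E, e.1 < e.2 ∧ e.1 ∈ V ∧ e.2 ∈ V)
    (hk : ∀ e ∈ E, (E.filter fun f => (f.1 < e.1 ∧ e.1 < f.2 ∧ f.2 < e.2) ∨
      (e.1 < f.1 ∧ f.1 < e.2 ∧ e.2 < f.2)).card ≤ k) :
    2 * E.card ≤ (2 * s + 3) * V.card := by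
  induction hn : V.card using Nat.strong_induction_on generalizing V E with
  | _ n ih =>
  subst hn
  let len : ℕ × ℕ → ℕ := fun e => (V.filter (· ∈ Set.Ioc e.1 e.2)).card
  by_cases hlong : ∃ e ∈ E, s < len e
  · obtain ⟨e, he, hmin⟩ := Finset.exists_min_image (E.filter fun e => s < len e) len
      (by obtain ⟨e, he, h⟩ := hlong; exact ⟨e, by simp [he, h]⟩)
    rw [Finset.mem_filter] at he
    obtain ⟨heE, hes⟩ := he
    obtain ⟨i, j⟩ := e
    obtain ⟨hij, hi, hj⟩ := hE _ heE
    simp only at hij hi hj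
    set W := V.filter (· ∈ Set.Ioo i j) with hW
    set U := V.filter (· ∈ Set.Icc i j) with hU
    have hlen : len (i, j) = W.card + 1 := by
      have : V.filter (· ∈ Set.Ioc i j) = insert j W := by
        ext x
        simp only [hW, Finset.mem_filter, Finset.mem_insert, Set.mem_Ioo, Set.mem_Ioc]
        grind
      simp only [len]
      rw [this, Finset.card_insert_of_notMem (by simp [hW])]
    have hUW : U.card = W.card + 2 := by
      have : U = insert i (insert j W) := by
        ext x
        simp only [hU, hW, Finset.mem_filter, Finset.mem_insert, Set.mem_Ioo, Set.mem_Icc]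
        grind
      rw [this, Finset.card_insert_of_notMem (by simp [hW]; omega),
        Finset.card_insert_of_notMem (by simp [hW])]
    have hWV : (V \ W).card + W.card = V.card :=
      Finset.card_sdiff_add_card_eq_card (Finset.filter_subset _ _)
    set E' := E.filter fun f => f.1 ∉ W ∧ f.2 ∉ W with hE'
    set X := E.filter fun f => (f.1 < i ∧ i < f.2 ∧ f.2 < j) ∨ (i < f.1 ∧ f.1 < j ∧ j < f.2)
      with hX
    set F := E.filter fun f => i ≤ f.1 ∧ f.2 ≤ j ∧ f ≠ (i, j) with hF
    have hsub : E ⊆ E' ∪ (X ∪ F) := by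
      rintro ⟨a, b⟩ hab
      obtain ⟨h1, h2, h3⟩ := hE _ hab
      simp only [hE', hX, hF, hW, Finset.mem_union, Finset.mem_filter, Set.mem_Ioo, hab, true_and,
        ne_eq, Prod.mk.injEq] at h1 h2 h3 ⊢
      simp only [h2, h3, true_and]
      omega
    have hcard : E.card ≤ E'.card + (X.card + F.card) :=
      (Finset.card_le_card hsub).trans ((Finset.card_union_le _ _).trans
        (Nat.add_le_add_left (Finset.card_union_le _ _) _))
    have hXk : X.card ≤ k := hk _ heE
    have hFcard : 2 * F.card + s * (s + 1) ≤ 2 * s * U.card := by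
      refine two_mul_card_short_pairs_add_le U s (by omega) F ?_
      rintro ⟨a, b⟩ hab
      simp only [hF, Finset.mem_filter, ne_eq, Prod.mk.injEq] at hab
      obtain ⟨habE, hia, hbj, hne⟩ := hab
      obtain ⟨h1, h2, h3⟩ := hE _ habE
      simp only at h1 h2 h3
      refine ⟨h1, ?_, ?_, ?_⟩
      · simp only [hU, Finset.mem_filter, Set.mem_Icc]; grind
      · simp only [hU, Finset.mem_filter, Set.mem_Icc]; grind
      · have hle : (U.filter (· ∈ Set.Ioc a b)).card ≤ len (a, b) :=
          Finset.card_le_card (Finset.filter_subset_filter _ (Finset.filter_subset _ _))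
        refine hle.trans ?_
        by_contra! hlt
        have hge := hmin (a, b) (by simp [habE, hlt])
        refine hge.not_gt (Finset.card_lt_card ((Finset.ssubset_iff_of_subset ?_).2 ?_))
        · intro x
          simp only [Finset.mem_filter, Set.mem_Ioc]
          grind
        · by_cases hai : a = i
          · refine ⟨j, ?_, ?_⟩ <;> simp only [Finset.mem_filter, Set.mem_Ioc] <;> grind
          · refine ⟨a, ?_, ?_⟩ <;> simp only [Finset.mem_filter, Set.mem_Ioc] <;> grind
    have hind : 2 * E'.card ≤ (2 * s + 3) * (V \ W).card := by
      refine ih (V \ W).card (by omega) (V \ W) E' ?_ ?_ rfl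
      · intro f hf
        simp only [hE', Finset.mem_filter] at hf
        obtain ⟨h1, h2, h3⟩ := hE f hf.1
        simp only [Finset.mem_sdiff]
        exact ⟨h1, ⟨h2, hf.2.1⟩, h3, hf.2.2⟩
      · intro f hf
        exact (Finset.card_le_card (Finset.filter_subset_filter _ (Finset.filter_subset _ _))).trans
          (hk f (Finset.mem_filter.1 hf).1)
    rw [hUW] at hFcard
    rw [← hWV]
    nlinarith
  · push Not at hlong
    by_cases hsV : s ≤ V.card
    · have := two_mul_card_short_pairs_add_le V s hsV E
        (fun e he => ⟨(hE e he).1, (hE e he).2.1, (hE e he).2.2, hlong e he⟩)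
      nlinarith
    · have := two_mul_card_short_pairs_add_le V V.card le_rfl E
        (fun e he => ⟨(hE e he).1, (hE e he).2.1, (hE e he).2.2,
          Finset.card_le_card (Finset.filter_subset _ _)⟩)
      nlinarith

theorem OuterKPlanar.two_mul_card_le {G : ConvexGeomGraph} {k : ℕ} (hG : OuterKPlanar G k) {s : ℕ}
    (hs : 1 ≤ s) (hks : 2 * k ≤ s * s) : 2 * G.E.card ≤ (2 * s + 3) * G.V.card := by
  obtain ⟨f, hinj, hor⟩ := G.convexPos.exists_numbering
  let g : Sym2 Pt → ℕ × ℕ := fun e => ((e.map f).inf, (e.map f).sup)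
  have hrep : ∀ e ∈ G.E, ∃ a ∈ G.V, ∃ b ∈ G.V, e = s(a, b) ∧ f a < f b ∧ g e = (f a, f b) := by
    intro e he
    induction e using Sym2.ind with
    | _ a b =>
    have ha := G.mem_V _ he a (by simp)
    have hb := G.mem_V _ he b (by simp)
    have hne : f a ≠ f b := fun h => G.not_diag _ he (by simpa using hinj ha hb h)
    rcases hne.lt_or_gt with h | h
    · exact ⟨a, ha, b, hb, rfl, h, by simp [g, h.le]⟩
    · exact ⟨b, hb, a, ha, Sym2.eq_swap, h, by simp [g, h.le]⟩
  have ginj : Set.InjOn g G.E := by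
    intro e he e' he' h
    obtain ⟨a, ha, b, hb, rfl, -, hg⟩ := hrep e he
    obtain ⟨a', ha', b', hb', rfl, -, hg'⟩ := hrep e' he'
    rw [hg, hg', Prod.mk.injEq] at h
    rw [hinj ha ha' h.1, hinj hb hb' h.2]
  have hcross : ∀ a ∈ G.V, ∀ b ∈ G.V, ∀ c ∈ G.V, ∀ d ∈ G.V, f a < f b → f b < f c → f c < f d →
      Cross s(a, c) s(b, d) := by
    intro a ha b hb c hc d hd hab hbc hcd
    refine ⟨?_, openSegment_inter_nonempty_of_orient_pos (hor a ha b hb c hc hab hbc)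
      (hor a ha b hb d hd hab (hbc.trans hcd)) (hor a ha c hc d hd (hab.trans hbc) hcd)
      (hor b hb c hc d hd hbc hcd)⟩
    intro h
    rcases Sym2.eq_iff.1 h with ⟨rfl, -⟩ | ⟨rfl, -⟩ <;> omega
  rw [← Finset.card_image_of_injOn ginj, ← Finset.card_image_of_injOn hinj]
  refine two_mul_card_edges_le k s hs hks _ _ ?_ ?_
  · intro p hp
    obtain ⟨e, he, rfl⟩ := Finset.mem_image.1 hp
    obtain ⟨a, ha, b, hb, -, hab, hg⟩ := hrep e he
    rw [hg]
    exact ⟨hab, Finset.mem_image_of_mem f ha, Finset.mem_image_of_mem f hb⟩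
  · intro p hp
    obtain ⟨e, he, rfl⟩ := Finset.mem_image.1 hp
    refine le_trans ?_ (hG e he)
    refine (Finset.card_le_card ?_).trans (Finset.card_image_le (f := g))
    intro q hq
    obtain ⟨hqE, hq⟩ := Finset.mem_filter.1 hq
    obtain ⟨e', he', rfl⟩ := Finset.mem_image.1 hqE
    refine Finset.mem_image_of_mem g (Finset.mem_filter.2 ⟨he', ?_⟩)
    obtain ⟨a, ha, b, hb, rfl, -, hg⟩ := hrep e he
    obtain ⟨a', ha', b', hb', rfl, -, hg'⟩ := hrep e' he'
    rw [hg, hg'] at hq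
    rcases hq with ⟨h1, h2, h3⟩ | ⟨h1, h2, h3⟩
    · exact (Cross_comm _ _).1 (hcross a' ha' a ha b' hb' b hb h1 h2 h3)
    · exact hcross a ha a' ha' b hb b' hb' h1 h2 h3

/-- for every ε > 0 there is K so that for all k ≥ K every outer
k-planar graph on n vertices has at most (√2 + ε)·√k·n + n edges. -/
theorem stmt8 (ε : ℝ) (hε : 0 < ε) :
    ∃ K : ℕ, ∀ k : ℕ, K ≤ k → ∀ G : ConvexGeomGraph, OuterKPlanar G k →
      (G.E.card : ℝ) ≤ (Real.sqrt 2 + ε) * Real.sqrt k * G.V.card + G.V.card := by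
  obtain ⟨K, hK⟩ := exists_nat_gt ((3 / (2 * ε)) ^ 2)
  refine ⟨K, fun k hk G hG => ?_⟩
  have hk' : (3 / (2 * ε)) ^ 2 < (k : ℝ) := hK.trans_le (by exact_mod_cast hk)
  have hk0 : (0 : ℝ) < k := lt_of_le_of_lt (sq_nonneg _) hk'
  have hεk : 3 / 2 ≤ ε * Real.sqrt k := by
    have h := Real.le_sqrt_of_sq_le hk'.le
    calc 3 / 2 = ε * (3 / (2 * ε)) := by field_simp
      _ ≤ ε * Real.sqrt k := by gcongr
  set s := ⌈Real.sqrt (2 * k)⌉₊ with hs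
  have hs_pos : 0 < s := Nat.ceil_pos.2 (Real.sqrt_pos.2 (by positivity))
  have hs_ge : Real.sqrt (2 * k) ≤ s := Nat.le_ceil _
  have hs_le : (s : ℝ) ≤ Real.sqrt 2 * Real.sqrt k + 1 := by
    rw [← Real.sqrt_mul (by norm_num)]
    exact (Nat.ceil_lt_add_one (Real.sqrt_nonneg _)).le
  have hks : 2 * k ≤ s * s := by
    have : (2 * k : ℝ) ≤ s ^ 2 := (Real.sqrt_le_left (by positivity)).1 hs_ge
    rw [← sq]
    exact_mod_cast this
  have hmain : (2 * G.E.card : ℝ) ≤ (2 * s + 3) * G.V.card := by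
    exact_mod_cast hG.two_mul_card_le hs_pos hks
  have hn : (0 : ℝ) ≤ G.V.card := by positivity
  have hcoef : (s : ℝ) + 3 / 2 ≤ (Real.sqrt 2 + ε) * Real.sqrt k + 1 := by linarith
  nlinarith [mul_le_mul_of_nonneg_right hcoef hn]
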